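/- arXiv:2102.08868 — 7 statements merged into one kernel-verified Lean document; each statement's English description precedes it below -/
import Mathlib

section
/- Let ‖·‖ be a norm on ℝ^d with dual norm ‖·‖_*. For any finite dataset x_1,…,x_n ∈ ℝ^d with labels y_1,…,y_n ∈ {−1,+1} that is linearly separable (affine), the supremum of all ε ≥ 0 for which there exist w ∈ ℝ^d and b ∈ ℝ with y_i(⟨w, x_i + δ⟩ + b) > 0 for all i and all δ with ‖δ‖ ≤ ε (the maximally robust radius) equals the maximum margin sup{ min_i y_i(⟨w, x_i⟩ + b) : w ∈ ℝ^d, b ∈ ℝ, ‖w‖_* ≤ 1 } (both taken in [0,∞]), and this common value is strictly positive. -/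
open scoped BigOperators ENNReal

/-- The dual norm of a norm `N` on `ℝ^d`, w.r.t. the standard inner product. -/
noncomputable def dualNorm {d : ℕ} (N : (Fin d → ℝ) → ℝ) (w : Fin d → ℝ) : ℝ :=
  sSup {t : ℝ | ∃ u : Fin d → ℝ, N u ≤ 1 ∧ t = |∑ j, w j * u j|}

/-- On a finite-dimensional real space, every linear functional is bounded with respect to
every norm. -/
theorem exists_pos_abs_le_mul_norm {E : Type*} [AddCommGroup E] [Module ℝ E]
    [FiniteDimensional ℝ E] (N : E → ℝ) (htri : ∀ u v, N (u + v) ≤ N u + N v)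
    (hsmul : ∀ (c : ℝ) (v : E), N (c • v) = |c| * N v) (heq : ∀ v, N v = 0 → v = 0)
    (f : E →ₗ[ℝ] ℝ) : ∃ C : ℝ, 0 < C ∧ ∀ u, |f u| ≤ C * N u := by
  let p : AddGroupNorm E :=
    { toFun := N
      map_zero' := by simpa using hsmul 0 0
      add_le' := htri
      neg' := fun v => by simpa using hsmul (-1) v
      eq_zero_of_map_eq_zero' := heq }
  let _ : NormedAddCommGroup E := p.toNormedAddCommGroup
  let _ : NormedSpace ℝ E := ⟨fun c v => (hsmul c v).le⟩
  refine ⟨‖LinearMap.toContinuousLinearMap f‖ + 1, by positivity, fun u => ?_⟩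
  have h : |f u| ≤ ‖LinearMap.toContinuousLinearMap f‖ * ‖u‖ :=
    (LinearMap.toContinuousLinearMap f).le_opNorm u
  have hu : (0 : ℝ) ≤ ‖u‖ := norm_nonneg u
  change |f u| ≤ (‖LinearMap.toContinuousLinearMap f‖ + 1) * ‖u‖
  linarith

theorem exists_pos_abs_sum_mul_le {d : ℕ} (N : (Fin d → ℝ) → ℝ)
    (htri : ∀ u v, N (u + v) ≤ N u + N v)
    (hsmul : ∀ (c : ℝ) (v : Fin d → ℝ), N (c • v) = |c| * N v) (heq : ∀ v, N v = 0 → v = 0)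
    (w : Fin d → ℝ) : ∃ C : ℝ, 0 < C ∧ ∀ u : Fin d → ℝ, |∑ j, w j * u j| ≤ C * N u :=
  exists_pos_abs_le_mul_norm N htri hsmul heq (Fintype.linearCombination ℝ w) |>.imp
    fun C hC => ⟨hC.1, fun u => by
      simpa [Fintype.linearCombination_apply, mul_comm] using hC.2 u⟩

theorem abs_sum_mul_le_of_dualNorm_le_one {d : ℕ} (N : (Fin d → ℝ) → ℝ)
    (htri : ∀ u v, N (u + v) ≤ N u + N v)
    (hsmul : ∀ (c : ℝ) (v : Fin d → ℝ), N (c • v) = |c| * N v) (heq : ∀ v, N v = 0 → v = 0)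
    {w : Fin d → ℝ} (hw : dualNorm N w ≤ 1) (u : Fin d → ℝ) : |∑ j, w j * u j| ≤ N u := by
  obtain ⟨C, hC, hCu⟩ := exists_pos_abs_sum_mul_le N htri hsmul heq w
  have hu : 0 ≤ N u := by
    have := (abs_nonneg _).trans (hCu u)
    exact nonneg_of_mul_nonneg_right this hC
  rcases hu.eq_or_lt with h0 | hpos
  · simpa [← h0] using hCu u
  have hbdd : BddAbove {t : ℝ | ∃ v : Fin d → ℝ, N v ≤ 1 ∧ t = |∑ j, w j * v j|} := by
    refine ⟨C, ?_⟩
    rintro _ ⟨v, hv, rfl⟩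
    exact (hCu v).trans (mul_le_of_le_one_right hC.le hv)
  have hunit : |∑ j, w j * ((N u)⁻¹ • u) j| ≤ 1 := by
    refine (le_csSup hbdd ⟨(N u)⁻¹ • u, ?_, rfl⟩).trans hw
    rw [hsmul, abs_of_pos (inv_pos.2 hpos), inv_mul_cancel₀ hpos.ne']
  have hsum : ∑ j, w j * ((N u)⁻¹ • u) j = (N u)⁻¹ * ∑ j, w j * u j := by
    simp only [Pi.smul_apply, smul_eq_mul, Finset.mul_sum]
    exact Finset.sum_congr rfl fun j _ => by ring
  rwa [hsum, abs_mul, abs_of_pos (inv_pos.2 hpos), inv_mul_le_iff₀ hpos, mul_one] at hunit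

theorem sub_abs_le_mul_sum_add {d : ℕ} {y : ℝ} (hy : y = 1 ∨ y = -1) (w x δ : Fin d → ℝ) (b : ℝ) :
    y * ((∑ j, w j * x j) + b) - |∑ j, w j * δ j| ≤ y * ((∑ j, w j * (x j + δ j)) + b) := by
  simp only [mul_add, Finset.sum_add_distrib]
  rcases hy with rfl | rfl
  · linarith [neg_abs_le (∑ j, w j * δ j)]
  · linarith [le_abs_self (∑ j, w j * δ j)]

/-- A classifier robust at radius `t` has the functional margin `t * |⟨w, u⟩|` at every
data point, for every `u` in the unit ball. -/
theorem mul_abs_sum_le_of_robust {d : ℕ} (N : (Fin d → ℝ) → ℝ)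
    (hsmul : ∀ (c : ℝ) (v : Fin d → ℝ), N (c • v) = |c| * N v) {y : ℝ} (hy : y = 1 ∨ y = -1)
    {w x : Fin d → ℝ} {b t : ℝ} (ht : 0 ≤ t)
    (h : ∀ δ, N δ ≤ t → 0 < y * ((∑ j, w j * (x j + δ j)) + b)) {u : Fin d → ℝ} (hu : N u ≤ 1) :
    t * |∑ j, w j * u j| ≤ y * ((∑ j, w j * x j) + b) := by
  have key : ∀ c : ℝ, |c| = t →
      0 < y * ((∑ j, w j * x j) + b) + y * (c * ∑ j, w j * u j) := by
    intro c hc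
    have h1 := h (c • u) (by rw [hsmul, hc]; exact mul_le_of_le_one_right ht hu)
    have h2 : ∑ j, w j * (x j + (c • u) j) = (∑ j, w j * x j) + c * ∑ j, w j * u j := by
      rw [Finset.mul_sum, ← Finset.sum_add_distrib]
      exact Finset.sum_congr rfl fun j _ => by simp only [Pi.smul_apply, smul_eq_mul]; ring
    rw [h2] at h1
    linarith
  have h1 := key t (abs_of_nonneg ht)
  have h2 := key (-t) (by rw [abs_neg, abs_of_nonneg ht])
  rcases abs_cases (∑ j, w j * u j) with ⟨ha, _⟩ | ⟨ha, _⟩ <;> rw [ha] <;>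
    rcases hy with rfl | rfl <;> linarith

/-- For a linearly separable (affine) dataset, the maximally robust radius equals
the maximum margin over the dual-norm unit ball, both taken in `[0,∞]`, and this
common value is strictly positive. -/
theorem stmt1 {d n : ℕ} (hn : 0 < n)
    (N : (Fin d → ℝ) → ℝ)
    (hN_tri : ∀ u v : Fin d → ℝ, N (u + v) ≤ N u + N v)
    (hN_smul : ∀ (c : ℝ) (v : Fin d → ℝ), N (c • v) = |c| * N v)
    (hN_eq : ∀ v : Fin d → ℝ, N v = 0 → v = 0)
    (x : Fin n → Fin d → ℝ) (y : Fin n → ℝ)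
    (hy : ∀ i, y i = 1 ∨ y i = -1)
    (hsep : ∃ (w : Fin d → ℝ) (b : ℝ), ∀ i, 0 < y i * ((∑ j, w j * x i j) + b)) :
    sSup {ε : ℝ≥0∞ | ∃ (w : Fin d → ℝ) (b : ℝ), ∀ (i : Fin n) (δ : Fin d → ℝ),
          ENNReal.ofReal (N δ) ≤ ε → 0 < y i * ((∑ j, w j * (x i j + δ j)) + b)}
      = sSup {m : ℝ≥0∞ | ∃ (w : Fin d → ℝ) (b : ℝ), dualNorm N w ≤ 1 ∧
          m = ENNReal.ofReal (⨅ i, y i * ((∑ j, w j * x i j) + b))}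
    ∧ 0 < sSup {ε : ℝ≥0∞ | ∃ (w : Fin d → ℝ) (b : ℝ), ∀ (i : Fin n) (δ : Fin d → ℝ),
          ENNReal.ofReal (N δ) ≤ ε → 0 < y i * ((∑ j, w j * (x i j + δ j)) + b)} := by
  have : Nonempty (Fin n) := ⟨⟨0, hn⟩⟩
  have hmin : ∀ (w : Fin d → ℝ) (b : ℝ) (i : Fin n),
      (⨅ i, y i * ((∑ j, w j * x i j) + b)) ≤ y i * ((∑ j, w j * x i j) + b) :=
    fun w b i => ciInf_le (Set.finite_range _).bddBelow i
  have hN_zero : N 0 = 0 := by simpa using hN_smul 0 0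
  refine ⟨le_antisymm (sSup_le ?_) (sSup_le ?_), ?_⟩
  · rintro ε ⟨w, b, h⟩
    refine ENNReal.le_of_forall_nnreal_lt fun r hr => ?_
    rcases eq_zero_or_pos r with rfl | hr0
    · simp
    have ht : (0 : ℝ) < r := hr0
    have hrob : ∀ i δ, N δ ≤ r → 0 < y i * ((∑ j, w j * (x i j + δ j)) + b) := fun i δ hδ =>
      h i δ ((ENNReal.ofReal_le_of_le_toReal (by simpa using hδ)).trans hr.le)
    obtain ⟨k, hk⟩ := exists_eq_ciInf_of_finite (f := fun i => y i * ((∑ j, w j * x i j) + b))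
    set m := ⨅ i, y i * ((∑ j, w j * x i j) + b) with hm
    have hm0 : 0 < m := by
      rw [← hk]
      simpa using hrob k 0 (by rw [hN_zero]; exact ht.le)
    have hs : 0 < r / m := div_pos ht hm0
    have hscale : ∀ v : Fin d → ℝ,
        ∑ j, ((r / m) • w) j * v j = r / m * ∑ j, w j * v j := fun v => by
      simp only [Pi.smul_apply, smul_eq_mul, Finset.mul_sum, mul_assoc]
    refine le_sSup ⟨(r / m) • w, r / m * b, csSup_le ⟨_, 0, by simp [hN_zero], rfl⟩ ?_, ?_⟩
    · rintro _ ⟨u, hu, rfl⟩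
      have := mul_abs_sum_le_of_robust N hN_smul (hy k) ht.le (hrob k) hu
      rw [hscale, abs_mul, abs_of_pos hs, div_mul_eq_mul_div, div_le_one hm0]
      exact this.trans hk.le
    · have : (⨅ i, y i * ((∑ j, ((r / m) • w) j * x i j) + r / m * b)) = r := by
        calc _ = ⨅ i, r / m * (y i * ((∑ j, w j * x i j) + b)) := by
              congr 1; ext i; rw [hscale]; ring
          _ = r / m * m := by rw [hm, Real.mul_iInf_of_nonneg hs.le]
          _ = r := div_mul_cancel₀ _ hm0.ne'
      rw [this, ENNReal.ofReal_coe_nnreal]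
  · rintro _ ⟨w, b, hw, rfl⟩
    refine ENNReal.le_of_forall_nnreal_lt fun r hr => le_sSup ⟨w, b, fun i δ hδ => ?_⟩
    have hr' : (r : ℝ) < ⨅ i, y i * ((∑ j, w j * x i j) + b) := by
      rwa [← ENNReal.ofReal_coe_nnreal, ENNReal.ofReal_lt_ofReal_iff_of_nonneg r.coe_nonneg] at hr
    rw [← ENNReal.ofReal_coe_nnreal, ENNReal.ofReal_le_ofReal_iff r.coe_nonneg] at hδ
    have h1 := abs_sum_mul_le_of_dualNorm_le_one N hN_tri hN_smul hN_eq hw δ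
    linarith [sub_abs_le_mul_sum_add (hy i) w (x i) δ b, hmin w b i]
  · obtain ⟨w, b, h⟩ := hsep
    obtain ⟨C, hC, hCu⟩ := exists_pos_abs_sum_mul_le N hN_tri hN_smul hN_eq w
    obtain ⟨k, hk⟩ := exists_eq_ciInf_of_finite (f := fun i => y i * ((∑ j, w j * x i j) + b))
    have hmin' := hmin w b
    rw [← hk] at hmin'
    have hm0 := h k
    set m := y k * ((∑ j, w j * x k j) + b)
    have ht : 0 < m / (2 * C) := by positivity
    refine (ENNReal.ofReal_pos.2 ht).trans_le (le_sSup ⟨w, b, fun i δ hδ => ?_⟩)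
    rw [ENNReal.ofReal_le_ofReal_iff ht.le, le_div_iff₀ (by positivity)] at hδ
    linarith [sub_abs_le_mul_sum_add (hy i) w (x i) δ b, hmin' i, hCu δ]
end

section
/- Let ‖·‖ be a norm on ℝ^d with dual norm ‖·‖_*. Let x_1,…,x_n ∈ ℝ^d with labels y_1,…,y_n ∈ {−1,+1} be a linearly separable (affine) dataset in which both labels +1 and −1 occur. Then the minimum-norm problem inf{ ‖w‖_* : w ∈ ℝ^d, b ∈ ℝ, y_i(⟨w,x_i⟩+b) ≥ 1 for all i } has a minimizer, its optimal value is strictly positive, and the maximum margin sup{ min_i y_i(⟨w,x_i⟩+b) : ‖w‖_* ≤ 1 } equals the reciprocal of this optimal value. -/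
open scoped BigOperators

/-- A definite seminorm on `ℝ^d` dominates a multiple of the sup norm. -/
theorem Seminorm.exists_norm_le_mul {d : ℕ} (p : Seminorm ℝ (Fin d → ℝ))
    (hp : ∀ v, p v = 0 → v = 0) : ∃ C : ℝ, ∀ v, ‖v‖ ≤ C * p v := by
  have hcont : Continuous p := p.convexOn.locallyLipschitz.continuous
  obtain ⟨a, ha, hmin⟩ := (isCompact_sphere (0 : Fin d → ℝ) 1).exists_forall_le'
    hcont.continuousOn (a := 0) fun v hv => by
      refine (apply_nonneg p v).lt_of_ne' fun h => ?_
      simp [hp v h] at hv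
  refine ⟨a⁻¹, fun v => ?_⟩
  rcases eq_or_ne v 0 with rfl | hv
  · simp
  have hv' : 0 < ‖v‖ := norm_pos_iff.mpr hv
  have h := hmin (‖v‖⁻¹ • v) (by simp [norm_smul, hv'.ne'])
  rw [map_smul_eq_mul, norm_inv, norm_norm, inv_mul_eq_div, le_div_iff₀ hv'] at h
  rwa [inv_mul_eq_div, le_div_iff₀' ha]

theorem abs_dotProduct_le_dualNorm {d : ℕ} (p : Seminorm ℝ (Fin d → ℝ))
    (hp : ∀ v, p v = 0 → v = 0) (w u : Fin d → ℝ) :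
    |w ⬝ᵥ u| ≤ dualNorm p w * p u := by
  obtain ⟨C, hC⟩ := p.exists_norm_le_mul hp
  have hbdd : BddAbove {t : ℝ | ∃ u : Fin d → ℝ, p u ≤ 1 ∧ t = |∑ j, w j * u j|} := by
    refine ⟨∑ j, |w j| * |C|, ?_⟩
    rintro _ ⟨u, hu, rfl⟩
    refine (Finset.abs_sum_le_sum_abs _ _).trans (Finset.sum_le_sum fun j _ => ?_)
    rw [abs_mul]
    refine mul_le_mul_of_nonneg_left ?_ (abs_nonneg _)
    calc |u j| ≤ ‖u‖ := norm_le_pi_norm u j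
      _ ≤ C * p u := hC u
      _ ≤ |C| * 1 := mul_le_mul (le_abs_self C) hu (apply_nonneg p u) (abs_nonneg C)
      _ = |C| := mul_one _
  rcases eq_or_ne u 0 with rfl | hu
  · simp
  have hpu : 0 < p u := (apply_nonneg p u).lt_of_ne' fun h => hu (hp u h)
  have h : |w ⬝ᵥ ((p u)⁻¹ • u)| ≤ dualNorm p w :=
    le_csSup hbdd ⟨(p u)⁻¹ • u, by
      rw [map_smul_eq_mul, norm_inv, Real.norm_of_nonneg hpu.le, inv_mul_cancel₀ hpu.ne'], rfl⟩
  rwa [dotProduct_smul, smul_eq_mul, abs_mul, abs_inv, abs_of_pos hpu, inv_mul_eq_div,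
    div_le_iff₀ hpu] at h

theorem dualNorm_nonneg {d : ℕ} (N : (Fin d → ℝ) → ℝ) (w : Fin d → ℝ) : 0 ≤ dualNorm N w := by
  apply Real.sSup_nonneg
  rintro _ ⟨u, -, rfl⟩
  exact abs_nonneg _

theorem dualNorm_le {d : ℕ} (p : Seminorm ℝ (Fin d → ℝ)) {w : Fin d → ℝ} {t : ℝ} (ht : 0 ≤ t)
    (h : ∀ u, |w ⬝ᵥ u| ≤ t * p u) : dualNorm p w ≤ t := by
  refine Real.sSup_le ?_ ht
  rintro _ ⟨u, hu, rfl⟩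
  exact (h u).trans (mul_le_of_le_one_right ht hu)

theorem dualNorm_smul_le {d : ℕ} (p : Seminorm ℝ (Fin d → ℝ)) (hp : ∀ v, p v = 0 → v = 0)
    {c : ℝ} (hc : 0 ≤ c) (w : Fin d → ℝ) : dualNorm p (c • w) ≤ c * dualNorm p w := by
  refine dualNorm_le p (mul_nonneg hc (dualNorm_nonneg _ _)) fun u => ?_
  rw [smul_dotProduct, smul_eq_mul, abs_mul, abs_of_nonneg hc, mul_assoc]
  exact mul_le_mul_of_nonneg_left (abs_dotProduct_le_dualNorm p hp w u) hc

/-- The affine functional `(w, b)` classifies all data points with margin at least one. -/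
def HasUnitMargin {d n : ℕ} (x : Fin n → Fin d → ℝ) (y : Fin n → ℝ) (w : Fin d → ℝ) (b : ℝ) :
    Prop :=
  ∀ i, 1 ≤ y i * (w ⬝ᵥ x i + b)

theorem HasUnitMargin.of_le {d n : ℕ} {x : Fin n → Fin d → ℝ} {y : Fin n → ℝ} {w : Fin d → ℝ}
    {b m : ℝ} (hm : 0 < m) (h : ∀ i, m ≤ y i * (w ⬝ᵥ x i + b)) :
    HasUnitMargin x y (m⁻¹ • w) (m⁻¹ * b) := fun i => by
  have h' : y i * ((m⁻¹ • w) ⬝ᵥ x i + m⁻¹ * b) = m⁻¹ * (y i * (w ⬝ᵥ x i + b)) := by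
    rw [smul_dotProduct, smul_eq_mul]; ring
  rw [h', inv_mul_eq_div, one_le_div hm]
  exact h i

theorem exists_dualNorm_minimizer {d n : ℕ} (p : Seminorm ℝ (Fin d → ℝ))
    (hp : ∀ v, p v = 0 → v = 0) (x : Fin n → Fin d → ℝ) (y : Fin n → ℝ)
    {i₁ i₂ : Fin n} (h₁ : y i₁ = 1) (h₂ : y i₂ = -1)
    {w₀ : Fin d → ℝ} {b₀ : ℝ} (h₀ : HasUnitMargin x y w₀ b₀) :
    ∃ w b, HasUnitMargin x y w b ∧
      ∀ w' b', HasUnitMargin x y w' b' → dualNorm p w ≤ dualNorm p w' := by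
  set D := dualNorm p w₀
  let S : Set ((Fin d → ℝ) × ℝ × ℝ) :=
    {z | HasUnitMargin x y z.1 z.2.1 ∧ (∀ u, |z.1 ⬝ᵥ u| ≤ z.2.2 * p u) ∧ 0 ≤ z.2.2 ∧ z.2.2 ≤ D}
  have hclosed : IsClosed S := by
    have hdot (u : Fin d → ℝ) :
        Continuous fun z : (Fin d → ℝ) × ℝ × ℝ => z.1 ⬝ᵥ u := by
      unfold dotProduct; fun_prop
    simp only [S, HasUnitMargin, Set.ofPred_and, Set.ofPred_forall]
    refine (isClosed_iInter fun i => isClosed_le continuous_const ?_).inter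
      ((isClosed_iInter fun u => isClosed_le (hdot u).abs ?_).inter
        ((isClosed_le continuous_const ?_).inter (isClosed_le ?_ continuous_const)))
    · exact continuous_const.mul ((hdot _).add (by fun_prop))
    all_goals fun_prop
  have hsub : S ⊆ Set.Icc
      ((fun j => -(D * p (Pi.single j 1)), 1 - D * p (x i₁), 0) : (Fin d → ℝ) × ℝ × ℝ)
      (fun j => D * p (Pi.single j 1), D * p (x i₂) - 1, D) := by
    rintro ⟨w, b, t⟩ ⟨hw, hu, ht, htD⟩
    have hu' (u) : |w ⬝ᵥ u| ≤ D * p u :=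
      (hu u).trans (mul_le_mul_of_nonneg_right htD (apply_nonneg p u))
    have hj (j) : |w j| ≤ D * p (Pi.single j 1) := by simpa using hu' (Pi.single j 1)
    have hw₁ := hw i₁
    have hw₂ := hw i₂
    rw [h₁] at hw₁
    rw [h₂] at hw₂
    have hx₁ := (abs_le.mp (hu' (x i₁))).2
    have hx₂ := (abs_le.mp (hu' (x i₂))).1
    dsimp only at hw₁ hw₂
    exact ⟨⟨fun j => (abs_le.mp (hj j)).1, by dsimp only; linarith, ht⟩,
      ⟨fun j => (abs_le.mp (hj j)).2, by dsimp only; linarith, htD⟩⟩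
  have hmem {w b} (hw : HasUnitMargin x y w b) (hle : dualNorm p w ≤ D) :
      (w, b, dualNorm p w) ∈ S :=
    ⟨hw, abs_dotProduct_le_dualNorm p hp w, dualNorm_nonneg _ _, hle⟩
  obtain ⟨⟨w, b, t⟩, ⟨hw, hu, ht, htD⟩, hmin⟩ :=
    (isCompact_Icc.of_isClosed_subset hclosed hsub).exists_isMinOn
      ⟨_, hmem h₀ le_rfl⟩ (f := fun z => z.2.2) (by fun_prop)
  refine ⟨w, b, hw, fun w' b' hw' => (dualNorm_le p ht hu).trans ?_⟩
  rcases le_total (dualNorm p w') D with h | h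
  · exact hmin (hmem hw' h)
  · exact htD.trans h

theorem HasUnitMargin.dualNorm_pos {d n : ℕ} {p : Seminorm ℝ (Fin d → ℝ)}
    (hp : ∀ v, p v = 0 → v = 0) {x : Fin n → Fin d → ℝ} {y : Fin n → ℝ}
    {i₁ i₂ : Fin n} (h₁ : y i₁ = 1) (h₂ : y i₂ = -1)
    {w : Fin d → ℝ} {b : ℝ} (h : HasUnitMargin x y w b) : 0 < dualNorm p w := by
  refine (dualNorm_nonneg _ _).lt_of_ne' fun h0 => ?_
  have hz (u) : w ⬝ᵥ u = 0 := by simpa [h0] using abs_dotProduct_le_dualNorm p hp w u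
  have hw₁ := h i₁
  have hw₂ := h i₂
  rw [h₁, hz] at hw₁
  rw [h₂, hz] at hw₂
  linarith

theorem HasUnitMargin.isGreatest_margin {d n : ℕ} [NeZero n] {p : Seminorm ℝ (Fin d → ℝ)}
    (hp : ∀ v, p v = 0 → v = 0) {x : Fin n → Fin d → ℝ} {y : Fin n → ℝ}
    {w : Fin d → ℝ} {b : ℝ} (h : HasUnitMargin x y w b) (hpos : 0 < dualNorm p w)
    (hmin : ∀ w' b', HasUnitMargin x y w' b' → dualNorm p w ≤ dualNorm p w') :
    IsGreatest {m : ℝ | ∃ (w' : Fin d → ℝ) (b' : ℝ), dualNorm p w' ≤ 1 ∧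
      m = ⨅ i, y i * (w' ⬝ᵥ x i + b')} (dualNorm p w)⁻¹ := by
  have hub : ∀ w' b', dualNorm p w' ≤ 1 →
      ⨅ i, y i * (w' ⬝ᵥ x i + b') ≤ (dualNorm p w)⁻¹ := by
    intro w' b' hw'
    set m := ⨅ i, y i * (w' ⬝ᵥ x i + b')
    rcases le_or_gt m 0 with hm0 | hm0
    · exact hm0.trans (inv_nonneg.mpr hpos.le)
    have hle := hmin _ _ (HasUnitMargin.of_le hm0 fun i => ciInf_le (Set.finite_range _).bddBelow i)
    rw [le_inv_comm₀ hm0 hpos]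
    calc dualNorm p w ≤ dualNorm p (m⁻¹ • w') := hle
      _ ≤ m⁻¹ * dualNorm p w' := dualNorm_smul_le p hp (inv_nonneg.mpr hm0.le) w'
      _ ≤ m⁻¹ := mul_le_of_le_one_right (inv_nonneg.mpr hm0.le) hw'
  refine ⟨?_, ?_⟩
  · set c := (dualNorm p w)⁻¹
    have hc0 : 0 < c := inv_pos.mpr hpos
    have hnorm : dualNorm p (c • w) ≤ 1 :=
      (dualNorm_smul_le p hp hc0.le w).trans_eq (inv_mul_cancel₀ hpos.ne')
    refine ⟨c • w, c * b, hnorm, le_antisymm (le_ciInf fun i => ?_) (hub _ _ hnorm)⟩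
    have h' : y i * ((c • w) ⬝ᵥ x i + c * b) = c * (y i * (w ⬝ᵥ x i + b)) := by
      rw [smul_dotProduct, smul_eq_mul]; ring
    rw [h']
    exact le_mul_of_one_le_right hc0.le (h i)
  · rintro _ ⟨w', b', hw', rfl⟩
    exact hub w' b' hw'

/-- For a linearly separable dataset containing both labels, the minimum-dual-norm
problem has a minimizer, its optimal value is strictly positive, and the maximum
margin equals the reciprocal of this optimal value. -/
theorem stmt2 {d n : ℕ} (hn : 0 < n)
    (N : (Fin d → ℝ) → ℝ)
    (hN_tri : ∀ u v : Fin d → ℝ, N (u + v) ≤ N u + N v)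
    (hN_smul : ∀ (c : ℝ) (v : Fin d → ℝ), N (c • v) = |c| * N v)
    (hN_eq : ∀ v : Fin d → ℝ, N v = 0 → v = 0)
    (x : Fin n → Fin d → ℝ) (y : Fin n → ℝ)
    (hy : ∀ i, y i = 1 ∨ y i = -1)
    (hboth : (∃ i, y i = 1) ∧ (∃ i, y i = -1))
    (hsep : ∃ (w : Fin d → ℝ) (b : ℝ), ∀ i, 0 < y i * ((∑ j, w j * x i j) + b)) :
    ∃ (w : Fin d → ℝ) (b : ℝ),
      (∀ i, 1 ≤ y i * ((∑ j, w j * x i j) + b)) ∧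
      (∀ (w' : Fin d → ℝ) (b' : ℝ), (∀ i, 1 ≤ y i * ((∑ j, w' j * x i j) + b')) →
          dualNorm N w ≤ dualNorm N w') ∧
      0 < dualNorm N w ∧
      sSup {m : ℝ | ∃ (w' : Fin d → ℝ) (b' : ℝ), dualNorm N w' ≤ 1 ∧
          m = ⨅ i, y i * ((∑ j, w' j * x i j) + b')} = (dualNorm N w)⁻¹ := by
  obtain ⟨⟨i₁, h₁⟩, i₂, h₂⟩ := hboth
  obtain ⟨w₀, b₀, h₀⟩ := hsep
  have : NeZero n := ⟨hn.ne'⟩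
  let p : Seminorm ℝ (Fin d → ℝ) := Seminorm.of N hN_tri hN_smul
  have hp : ∀ v, p v = 0 → v = 0 := hN_eq
  obtain ⟨i₀, hi₀⟩ := Finite.exists_min fun i => y i * (w₀ ⬝ᵥ x i + b₀)
  obtain ⟨w, b, hw, hmin⟩ :=
    exists_dualNorm_minimizer p hp x y h₁ h₂ (HasUnitMargin.of_le (h₀ i₀) hi₀)
  have hpos := hw.dualNorm_pos hp h₁ h₂
  exact ⟨w, b, hw, hmin, hpos, (hw.isGreatest_margin hp hpos hmin).csSup_eq⟩
end

section
/- Let g ∈ ℝ^d, g ≠ 0, and let i be a coordinate with |g_i| = ‖g‖_∞. Then v := −‖g‖_∞ · sign(g_i) · e_i (where e_i is the i-th standard basis vector) is a minimizer over v ∈ ℝ^d of ⟨g, v⟩ + (1/2)‖v‖₁², and the minimum value is −(1/2)‖g‖_∞². That is, the coordinate descent step along a maximal-magnitude gradient coordinate is a steepest descent step with respect to the ℓ₁ norm. -/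
open scoped BigOperators

/-- If `|g j| ≤ M` for all `j`, then `-(1 / 2) * M ^ 2` is a lower bound for
`w ↦ ⟨g, w⟩ + (1 / 2) * ‖w‖₁ ^ 2`. -/
theorem neg_half_sq_le_sum_mul_add_half_sq_sum_abs {ι : Type*} [Fintype ι] {g : ι → ℝ} {M : ℝ}
    (hM : ∀ j, |g j| ≤ M) (w : ι → ℝ) :
    -(1 / 2) * M ^ 2 ≤ (∑ j, g j * w j) + (1 / 2) * (∑ j, |w j|) ^ 2 := by
  have h : -(M * ∑ j, |w j|) ≤ ∑ j, g j * w j := by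
    rw [Finset.mul_sum, ← Finset.sum_neg_distrib]
    refine Finset.sum_le_sum fun j _ => ?_
    have h₁ := neg_abs_le (g j * w j)
    rw [abs_mul] at h₁
    have h₂ := mul_le_mul_of_nonneg_right (hM j) (abs_nonneg (w j))
    linarith
  nlinarith [sq_nonneg (M - ∑ j, |w j|)]

/-- The coordinate descent step `v = −‖g‖_∞ · sign(g_i) · e_i` along a coordinate `i` of
maximal gradient magnitude is a steepest descent step for the linear functional
`v ↦ ⟨g,v⟩` with respect to the `ℓ₁` norm: it minimizes `⟨g,v⟩ + ½‖v‖₁²`, with minimum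
value `−½‖g‖_∞²`. -/
theorem stmt6 {d : ℕ} (g : Fin d → ℝ) (hg : g ≠ 0)
    (i : Fin d) (hi : |g i| = ⨆ j, |g j|) :
    let v : Fin d → ℝ := fun j => if j = i then -(⨆ k, |g k|) * Real.sign (g i) else 0
    ((∑ j, g j * v j) + (1 / 2) * (∑ j, |v j|) ^ 2 = -(1 / 2) * (⨆ k, |g k|) ^ 2)
    ∧ ∀ v' : Fin d → ℝ,
        (∑ j, g j * v j) + (1 / 2) * (∑ j, |v j|) ^ 2
          ≤ (∑ j, g j * v' j) + (1 / 2) * (∑ j, |v' j|) ^ 2 := by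
  intro v
  have hM : ∀ j, |g j| ≤ ⨆ k, |g k| := le_ciSup (Set.finite_range _).bddAbove
  have hmin : (∑ j, g j * v j) + (1 / 2) * (∑ j, |v j|) ^ 2 = -(1 / 2) * (⨆ k, |g k|) ^ 2 := by
    simp only [v, ← hi, mul_ite, mul_zero, apply_ite abs, abs_zero, Finset.sum_ite_eq',
      Finset.mem_univ, if_true, sq_abs]
    rcases lt_trichotomy (g i) 0 with h | h | h
    · rw [Real.sign_of_neg h, abs_of_neg h]; ring
    · simp [h]
    · rw [Real.sign_of_pos h, abs_of_pos h]; ring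
  exact ⟨hmin, fun w => hmin.trans_le (neg_half_sq_le_sum_mul_add_half_sq_sum_abs hM w)⟩
end

section
/- Let ‖·‖ be a norm on ℝ^d with dual norm ‖·‖_*, and let x_1,…,x_n ∈ ℝ^d with labels y_1,…,y_n ∈ {−1,+1}. Suppose w̄ ∈ ℝ^d with ‖w̄‖ ≤ 1 attains γ := max{ min_i y_i⟨w, x_i⟩ : ‖w‖ ≤ 1 } and γ > 0. Then: (a) for every ε < γ, every i, and every δ ∈ ℝ^d with ‖δ‖_* ≤ ε, one has y_i⟨w̄, x_i + δ⟩ > 0; and (b) for every ε > γ there is no w ∈ ℝ^d with y_i⟨w, x_i + δ⟩ > 0 for all i and all δ with ‖δ‖_* ≤ ε. That is, a maximum margin classifier with respect to ‖·‖ is a maximally robust classifier against perturbations bounded in the dual norm ‖·‖_*. -/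
open scoped BigOperators

section NormFunction

variable {E : Type*} [AddCommGroup E] [Module ℝ E] {N : E → ℝ}

theorem normFunction_nonneg (hN_tri : ∀ u v, N (u + v) ≤ N u + N v)
    (hN_smul : ∀ (c : ℝ) (v : E), N (c • v) = |c| * N v) (v : E) : 0 ≤ N v := by
  have h₀ : N 0 = 0 := by simpa using hN_smul 0 0
  have h₁ : N (-v) = N v := by simpa using hN_smul (-1) v
  have h₂ := hN_tri v (-v)
  rw [add_neg_cancel, h₀, h₁] at h₂
  linarith

/-- Linear functionals on a finite-dimensional space are bounded with respect to any norm. -/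
theorem exists_abs_le_mul_normFunction [FiniteDimensional ℝ E]
    (hN_tri : ∀ u v, N (u + v) ≤ N u + N v)
    (hN_smul : ∀ (c : ℝ) (v : E), N (c • v) = |c| * N v)
    (hN_eq : ∀ v, N v = 0 → v = 0) (f : E →ₗ[ℝ] ℝ) :
    ∃ C, 0 ≤ C ∧ ∀ u, |f u| ≤ C * N u := by
  let : Norm E := ⟨N⟩
  have core : NormedSpace.Core ℝ E :=
    { norm_nonneg := normFunction_nonneg hN_tri hN_smul
      norm_smul := hN_smul
      norm_triangle := hN_tri
      norm_eq_zero_iff := fun v => ⟨hN_eq v, by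
        rintro rfl
        exact (by simpa using hN_smul 0 0 : N 0 = 0)⟩ }
  let : NormedAddCommGroup E := NormedAddCommGroup.ofCore core
  let : NormedSpace ℝ E := NormedSpace.ofCore core
  exact ⟨‖LinearMap.toContinuousLinearMap f‖, norm_nonneg _,
    fun u => (LinearMap.toContinuousLinearMap f).le_opNorm u⟩

/-- Every vector has a supporting functional of the unit ball of `N`. -/
theorem exists_linearMap_eq_normFunction (hN_tri : ∀ u v, N (u + v) ≤ N u + N v)
    (hN_smul : ∀ (c : ℝ) (v : E), N (c • v) = |c| * N v) {w : E} (hw : w ≠ 0) :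
    ∃ g : E →ₗ[ℝ] ℝ, g w = N w ∧ ∀ u, |g u| ≤ N u := by
  obtain ⟨g, hg, hgN⟩ := exists_extension_of_le_sublinear
    (LinearPMap.mkSpanSingleton w (N w) hw) N
    (fun c hc v => by rw [hN_smul, abs_of_pos hc]) hN_tri (by
      rintro ⟨v, hv⟩
      obtain ⟨c, rfl⟩ := Submodule.mem_span_singleton.1 hv
      rw [LinearPMap.mkSpanSingleton'_apply, hN_smul, smul_eq_mul]
      exact mul_le_mul_of_nonneg_right (le_abs_self c)
        (normFunction_nonneg hN_tri hN_smul w))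
  refine ⟨g, ?_, fun u => abs_le.2 ⟨?_, hgN u⟩⟩
  · rw [hg ⟨w, Submodule.mem_span_singleton_self w⟩]
    exact LinearPMap.mkSpanSingleton_apply ℝ ℝ hw _
  · have h := hgN (-u)
    have h' : N (-u) = N u := by simpa using hN_smul (-1) u
    rw [map_neg, h'] at h
    linarith

end NormFunction

section DualNorm

variable {d : ℕ} {N : (Fin d → ℝ) → ℝ}

theorem abs_sum_mul_le_dualNorm (hN_tri : ∀ u v, N (u + v) ≤ N u + N v)
    (hN_smul : ∀ (c : ℝ) (v : Fin d → ℝ), N (c • v) = |c| * N v)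
    (hN_eq : ∀ v, N v = 0 → v = 0) (w : Fin d → ℝ) {u : Fin d → ℝ} (hu : N u ≤ 1) :
    |∑ j, w j * u j| ≤ dualNorm N w := by
  obtain ⟨C, hC, h⟩ := exists_abs_le_mul_normFunction hN_tri hN_smul hN_eq
    (Fintype.linearCombination ℝ w)
  refine le_csSup ⟨C, ?_⟩ ⟨u, hu, rfl⟩
  rintro _ ⟨v, hv, rfl⟩
  have hv' := h v
  simp only [Fintype.linearCombination_apply, smul_eq_mul, mul_comm (v _)] at hv'
  exact hv'.trans (mul_le_of_le_one_right hC hv)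

theorem dualNorm_le_s8 {w : Fin d → ℝ} {c : ℝ} (hc : 0 ≤ c)
    (h : ∀ u, N u ≤ 1 → |∑ j, w j * u j| ≤ c) : dualNorm N w ≤ c := by
  refine Real.sSup_le ?_ hc
  rintro _ ⟨u, hu, rfl⟩
  exact h u hu

end DualNorm

/-- A maximum margin classifier `w̄` with respect to a norm `‖·‖` (with positive maximum
margin `γ`) is maximally robust against perturbations bounded in the dual norm: it is
robust for every `ε < γ`, and no linear classifier is robust for any `ε > γ`. -/
theorem stmt8 {d n : ℕ} (hn : 0 < n)
    (N : (Fin d → ℝ) → ℝ)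
    (hN_tri : ∀ u v : Fin d → ℝ, N (u + v) ≤ N u + N v)
    (hN_smul : ∀ (c : ℝ) (v : Fin d → ℝ), N (c • v) = |c| * N v)
    (hN_eq : ∀ v : Fin d → ℝ, N v = 0 → v = 0)
    (x : Fin n → Fin d → ℝ) (y : Fin n → ℝ)
    (hy : ∀ i, y i = 1 ∨ y i = -1)
    (wbar : Fin d → ℝ) (hwbar : N wbar ≤ 1) (γ : ℝ)
    (hγ : γ = ⨅ i, y i * ∑ j, wbar j * x i j)
    (hmax : ∀ w : Fin d → ℝ, N w ≤ 1 → (⨅ i, y i * ∑ j, w j * x i j) ≤ γ)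
    (hγpos : 0 < γ) :
    (∀ ε : ℝ, ε < γ → ∀ (i : Fin n) (δ : Fin d → ℝ), dualNorm N δ ≤ ε →
        0 < y i * ∑ j, wbar j * (x i j + δ j)) ∧
    (∀ ε : ℝ, γ < ε →
        ¬ ∃ w : Fin d → ℝ, ∀ (i : Fin n) (δ : Fin d → ℝ), dualNorm N δ ≤ ε →
            0 < y i * ∑ j, w j * (x i j + δ j)) := by
  have : Nonempty (Fin n) := ⟨⟨0, hn⟩⟩
  have hy_abs : ∀ i, |y i| = 1 := fun i => by rcases hy i with h | h <;> simp [h]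
  have hy_sq : ∀ i, y i * y i = 1 := fun i => by rcases hy i with h | h <;> simp [h]
  refine ⟨fun ε hε i δ hδ => ?_, ?_⟩
  · have hmargin : γ ≤ y i * ∑ j, wbar j * x i j :=
      hγ ▸ ciInf_le (Set.finite_range _).bddBelow i
    have hpert : |y i * ∑ j, wbar j * δ j| ≤ ε := by
      rw [abs_mul, hy_abs, one_mul]
      simp only [mul_comm (wbar _)]
      exact (abs_sum_mul_le_dualNorm hN_tri hN_smul hN_eq δ hwbar).trans hδ
    simp only [mul_add, Finset.sum_add_distrib]
    linarith [(abs_le.1 hpert).1]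
  · rintro ε hε ⟨w, hw⟩
    have hε₀ : 0 < ε := hγpos.trans hε
    have hw₀ : w ≠ 0 := by
      rintro rfl
      have h := hw ⟨0, hn⟩ 0 (dualNorm_le_s8 hε₀.le fun u _ => by simpa using hε₀.le)
      simp at h
    have hNw : 0 < N w := lt_of_le_of_ne (normFunction_nonneg hN_tri hN_smul w)
      fun h => hw₀ (hN_eq w h.symm)
    obtain ⟨g, hgw, hgN⟩ := exists_linearMap_eq_normFunction hN_tri hN_smul hw₀
    have hg_sum : ∀ u, ∑ j, u j * g (Pi.single j 1) = g u := fun u => by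
      conv_rhs => rw [pi_eq_sum_univ' u]
      simp [map_sum, map_smul]
    obtain ⟨i, hi⟩ := exists_eq_ciInf_of_finite
      (f := fun i => y i * ∑ j, ((N w)⁻¹ • w) j * x i j)
    have hnorm : N ((N w)⁻¹ • w) ≤ 1 := by
      rw [hN_smul, abs_of_pos (inv_pos.2 hNw), inv_mul_cancel₀ hNw.ne']
    have hmargin := hi.trans_le (hmax _ hnorm)
    simp only [Pi.smul_apply, smul_eq_mul, mul_assoc, ← Finset.mul_sum] at hmargin
    rw [mul_left_comm, inv_mul_le_iff₀ hNw] at hmargin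
    have hpos := hw i (fun j => -(y i * ε) * g (Pi.single j 1)) <| by
      refine dualNorm_le_s8 hε₀.le fun u hu => ?_
      have hsum : ∑ j, -(y i * ε) * g (Pi.single j 1) * u j = -(y i * ε) * g u := by
        rw [← hg_sum u, Finset.mul_sum]
        exact Finset.sum_congr rfl fun j _ => by ring
      rw [hsum, abs_mul, abs_neg, abs_mul, hy_abs, one_mul, abs_of_pos hε₀]
      exact mul_le_of_le_one_right hε₀.le ((hgN u).trans hu)
    have hsum : ∑ j, w j * (x i j + -(y i * ε) * g (Pi.single j 1)) =
        ∑ j, w j * x i j - y i * ε * N w := by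
      rw [← hgw, ← hg_sum w, Finset.mul_sum, ← Finset.sum_sub_distrib]
      exact Finset.sum_congr rfl fun j _ => by ring
    rw [hsum, mul_sub, ← mul_assoc, ← mul_assoc, hy_sq, one_mul] at hpos
    nlinarith
end

section
/- Let ‖·‖ be a norm on ℝ^d with dual norm ‖·‖_*, let ζ : ℝ → ℝ be non-increasing, let w, x ∈ ℝ^d, y ∈ {−1,+1}, and ε ≥ 0. Then the worst-case loss over the ε-ball is attained and equals sup{ ζ(y⟨w, x + δ⟩) : δ ∈ ℝ^d, ‖δ‖ ≤ ε } = ζ( y⟨w, x⟩ − ε‖w‖_* ). -/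
open scoped BigOperators

/-- A linear functional on a finite-dimensional real space attains its maximal absolute value
over the unit ball of a norm. -/
theorem exists_abs_le_of_norm_le_one {E : Type*} [AddCommGroup E] [Module ℝ E]
    [FiniteDimensional ℝ E] (N : E → ℝ) (hN_nonneg : ∀ v, 0 ≤ N v)
    (hN_tri : ∀ u v, N (u + v) ≤ N u + N v)
    (hN_smul : ∀ (c : ℝ) v, N (c • v) = |c| * N v)
    (hN_eq : ∀ v, N v = 0 → v = 0) (f : E →ₗ[ℝ] ℝ) :
    ∃ u, N u ≤ 1 ∧ ∀ v, N v ≤ 1 → |f v| ≤ f u := by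
  let _ : Norm E := ⟨N⟩
  have core : NormedSpace.Core ℝ E :=
    { norm_nonneg := hN_nonneg
      norm_smul := hN_smul
      norm_triangle := hN_tri
      norm_eq_zero_iff := fun v => ⟨hN_eq v, by
        rintro rfl
        exact (by simpa using hN_smul 0 0 : N 0 = 0)⟩ }
  let _ : NormedAddCommGroup E := NormedAddCommGroup.ofCore core
  let _ : NormedSpace ℝ E := NormedSpace.ofCore core
  have : ProperSpace E := FiniteDimensional.proper ℝ E
  obtain ⟨u, hu, hmax⟩ := (isCompact_closedBall (0 : E) 1).exists_isMaxOn
    ⟨0, Metric.mem_closedBall_self zero_le_one⟩ f.continuous_of_finiteDimensional.continuousOn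
  refine ⟨u, mem_closedBall_zero_iff.mp hu, fun v hv => abs_le'.mpr ⟨?_, ?_⟩⟩
  · exact hmax (mem_closedBall_zero_iff.mpr hv)
  · rw [← map_neg]
    exact hmax (mem_closedBall_zero_iff.mpr ((norm_neg v).trans_le hv))

/-- The supremum defining the dual norm is attained, and it bounds the functional on every ball. -/
theorem dualNorm_attained {d : ℕ} (N : (Fin d → ℝ) → ℝ)
    (hN_tri : ∀ u v : Fin d → ℝ, N (u + v) ≤ N u + N v)
    (hN_smul : ∀ (c : ℝ) (v : Fin d → ℝ), N (c • v) = |c| * N v)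
    (hN_eq : ∀ v : Fin d → ℝ, N v = 0 → v = 0) (w : Fin d → ℝ) :
    (∃ u, N u ≤ 1 ∧ w ⬝ᵥ u = dualNorm N w) ∧
      ∀ (ε : ℝ) (v : Fin d → ℝ), N v ≤ ε → |w ⬝ᵥ v| ≤ ε * dualNorm N w := by
  have hN_nonneg : ∀ v, 0 ≤ N v := fun v => by
    have h0 : N 0 = 0 := by simpa using hN_smul 0 0
    have hneg : N (-v) = N v := by simpa using hN_smul (-1) v
    have h := hN_tri v (-v)
    rw [add_neg_cancel, h0, hneg] at h
    linarith
  obtain ⟨u, hu, hmax⟩ := exists_abs_le_of_norm_le_one N hN_nonneg hN_tri hN_smul hN_eq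
    (dotProductBilin ℝ ℝ w)
  simp only [dotProductBilin_apply_apply] at hmax
  have hnorm : dualNorm N w = w ⬝ᵥ u := by
    refine IsGreatest.csSup_eq ⟨⟨u, hu, ?_⟩, ?_⟩
    · exact le_antisymm (le_abs_self _) (hmax u hu)
    · rintro t ⟨v, hv, rfl⟩
      exact hmax v hv
  refine ⟨⟨u, hu, hnorm.symm⟩, fun ε v hv => ?_⟩
  rw [hnorm]
  have hu_nonneg : 0 ≤ w ⬝ᵥ u := (abs_nonneg _).trans (hmax u hu)
  rcases (hN_nonneg v).eq_or_lt with h | h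
  · rw [hN_eq v h.symm, dotProduct_zero, abs_zero]
    exact mul_nonneg ((hN_nonneg v).trans hv) hu_nonneg
  · have hscaled := hmax ((N v)⁻¹ • v) (by
      rw [hN_smul, abs_of_pos (inv_pos.mpr h), inv_mul_cancel₀ h.ne'])
    rw [dotProduct_smul, smul_eq_mul, abs_mul, abs_of_pos (inv_pos.mpr h),
      inv_mul_le_iff₀ h] at hscaled
    exact hscaled.trans (mul_le_mul_of_nonneg_right hv hu_nonneg)

/-- For a non-increasing loss `ζ`, the worst-case loss of a linear classifier over the
`ε`-ball is attained and equals `ζ(y⟨w,x⟩ − ε‖w‖_*)`. -/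
theorem stmt16 {d : ℕ}
    (N : (Fin d → ℝ) → ℝ)
    (hN_tri : ∀ u v : Fin d → ℝ, N (u + v) ≤ N u + N v)
    (hN_smul : ∀ (c : ℝ) (v : Fin d → ℝ), N (c • v) = |c| * N v)
    (hN_eq : ∀ v : Fin d → ℝ, N v = 0 → v = 0)
    (ζ : ℝ → ℝ) (hζ : ∀ s t : ℝ, s ≤ t → ζ t ≤ ζ s)
    (w x : Fin d → ℝ) (y : ℝ) (hy : y = 1 ∨ y = - 1) (ε : ℝ) (hε : 0 ≤ ε) :
    IsGreatest {t : ℝ | ∃ δ : Fin d → ℝ, N δ ≤ ε ∧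
        t = ζ (y * ∑ j, w j * (x j + δ j))}
      (ζ (y * (∑ j, w j * x j) - ε * dualNorm N w)) := by
  obtain ⟨⟨u, hu, hu_eq⟩, hbound⟩ := dualNorm_attained N hN_tri hN_smul hN_eq w
  have hsum : ∀ δ : Fin d → ℝ, ∑ j, w j * (x j + δ j) = w ⬝ᵥ x + w ⬝ᵥ δ :=
    fun δ => dotProduct_add w x δ
  have hx : ∑ j, w j * x j = w ⬝ᵥ x := rfl
  have hyy : y * y = 1 := by rcases hy with rfl | rfl <;> norm_num
  have hy_abs : |y| = 1 := by rcases hy with rfl | rfl <;> norm_num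
  simp only [hsum, hx]
  constructor
  · refine ⟨(-(ε * y)) • u, ?_, ?_⟩
    · rw [hN_smul, abs_neg, abs_mul, hy_abs, abs_of_nonneg hε, mul_one]
      exact mul_le_of_le_one_right hε hu
    · congr 1
      rw [dotProduct_smul, smul_eq_mul, hu_eq]
      linear_combination (ε * dualNorm N w) * hyy
  · rintro t ⟨δ, hδ, rfl⟩
    apply hζ
    have h : |y * (w ⬝ᵥ δ)| ≤ ε * dualNorm N w := by
      rw [abs_mul, hy_abs, one_mul]
      exact hbound ε δ hδ
    linarith [neg_le_of_abs_le h]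
end

section
/- Let ‖·‖ be a norm on ℝ^d with dual norm ‖·‖_*, let w, x ∈ ℝ^d, y ∈ {−1,+1}, and ε ≥ 0. Then the worst-case hinge loss over the ε-ball satisfies max{ [1 − y⟨w, x + δ⟩]_+ : δ ∈ ℝ^d, ‖δ‖ ≤ ε } = [1 − y⟨w, x⟩ + ε‖w‖_*]_+, where [t]_+ := max(t, 0). -/
open scoped BigOperators

/-- The closed unit ball of a norm on `ℝ^d` is compact. -/
theorem isCompact_setOf_seminorm_le_one {d : ℕ} (p : Seminorm ℝ (Fin d → ℝ))
    (hp : ∀ v, p v = 0 → v = 0) : IsCompact {v | p v ≤ 1} := by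
  have hcont : Continuous p := by
    rw [← continuousOn_univ]
    exact p.convexOn.continuousOn isOpen_univ
  obtain ⟨m, hm, hmin⟩ := (isCompact_sphere (0 : Fin d → ℝ) 1).exists_forall_le'
    hcont.continuousOn (a := 0) fun v hv => by
      refine lt_of_le_of_ne (apply_nonneg p v) fun h => ?_
      simp [hp v h.symm] at hv
  refine Metric.isCompact_of_isClosed_isBounded (isClosed_le hcont continuous_const)
    ((Metric.isBounded_closedBall (x := (0 : Fin d → ℝ)) (r := m⁻¹)).subset fun v hv => ?_)
  rw [mem_closedBall_zero_iff]
  rcases eq_or_ne v 0 with rfl | hv0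
  · simpa using hm.le
  have hnorm : 0 < ‖v‖ := norm_pos_iff.mpr hv0
  have h := hmin (‖v‖⁻¹ • v) (by simp [norm_smul, hnorm.ne'])
  rw [map_smul_eq_mul, norm_inv, norm_norm, inv_mul_eq_div, le_div_iff₀ hnorm] at h
  rw [le_inv_comm₀ hnorm hm, ← one_div, le_div_iff₀ hnorm]
  exact h.trans hv

/-- The supremum defining the dual norm is attained. -/
theorem isGreatest_dualNorm {d : ℕ} (p : Seminorm ℝ (Fin d → ℝ))
    (hp : ∀ v, p v = 0 → v = 0) (w : Fin d → ℝ) :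
    IsGreatest {t : ℝ | ∃ u : Fin d → ℝ, p u ≤ 1 ∧ t = |∑ j, w j * u j|} (dualNorm p w) := by
  have himage : {t : ℝ | ∃ u : Fin d → ℝ, p u ≤ 1 ∧ t = |∑ j, w j * u j|} =
      (fun u : Fin d → ℝ => |∑ j, w j * u j|) '' {u | p u ≤ 1} := by
    ext t
    simp [eq_comm]
  have hcompact : IsCompact {t : ℝ | ∃ u : Fin d → ℝ, p u ≤ 1 ∧ t = |∑ j, w j * u j|} := by
    rw [himage]
    exact (isCompact_setOf_seminorm_le_one p hp).image (by fun_prop)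
  exact hcompact.isGreatest_sSup ⟨_, 0, by simp, rfl⟩

/-- Hölder's inequality for a norm and its dual. -/
theorem abs_sum_mul_le_mul_dualNorm {d : ℕ} (p : Seminorm ℝ (Fin d → ℝ))
    (hp : ∀ v, p v = 0 → v = 0) (w v : Fin d → ℝ) :
    |∑ j, w j * v j| ≤ p v * dualNorm p w := by
  rcases eq_or_ne v 0 with rfl | hv
  · simp
  have hpv : 0 < p v := lt_of_le_of_ne (apply_nonneg p v) fun h => hv (hp v h.symm)
  have h := (isGreatest_dualNorm p hp w).2 ⟨(p v)⁻¹ • v, by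
    rw [map_smul_eq_mul, Real.norm_of_nonneg (inv_nonneg.mpr hpv.le),
      inv_mul_cancel₀ hpv.ne'], rfl⟩
  simp only [Pi.smul_apply, smul_eq_mul, mul_left_comm (w _), ← Finset.mul_sum, abs_mul,
    abs_inv, abs_of_pos hpv] at h
  rwa [inv_mul_le_iff₀ hpv] at h

/-- The minimum of `⟨w, ·⟩` over the unit ball is minus the dual norm. -/
theorem exists_sum_mul_eq_neg_dualNorm {d : ℕ} (p : Seminorm ℝ (Fin d → ℝ))
    (hp : ∀ v, p v = 0 → v = 0) (w : Fin d → ℝ) :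
    ∃ u, p u ≤ 1 ∧ ∑ j, w j * u j = -dualNorm p w := by
  obtain ⟨u, hu, h⟩ := (isGreatest_dualNorm p hp w).1
  rcases abs_choice (∑ j, w j * u j) with hs | hs
  · exact ⟨-u, by rwa [map_neg_eq_map], by simp [h, hs]⟩
  · exact ⟨u, hu, by simp [h, hs]⟩

/-- The worst-case hinge loss of a linear classifier over the `ε`-ball is attained and
equals `[1 − y⟨w,x⟩ + ε‖w‖_*]₊`. -/
theorem stmt17 {d : ℕ}
    (N : (Fin d → ℝ) → ℝ)
    (hN_tri : ∀ u v : Fin d → ℝ, N (u + v) ≤ N u + N v)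
    (hN_smul : ∀ (c : ℝ) (v : Fin d → ℝ), N (c • v) = |c| * N v)
    (hN_eq : ∀ v : Fin d → ℝ, N v = 0 → v = 0)
    (w x : Fin d → ℝ) (y : ℝ) (hy : y = 1 ∨ y = - 1) (ε : ℝ) (hε : 0 ≤ ε) :
    IsGreatest {t : ℝ | ∃ δ : Fin d → ℝ, N δ ≤ ε ∧
        t = max (1 - y * ∑ j, w j * (x j + δ j)) 0}
      (max (1 - y * (∑ j, w j * x j) + ε * dualNorm N w) 0) := by
  let p : Seminorm ℝ (Fin d → ℝ) := Seminorm.of N hN_tri hN_smul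
  have hy2 : y * y = 1 := by rcases hy with rfl | rfl <;> norm_num
  have hyabs : |y| = 1 := by rcases hy with rfl | rfl <;> norm_num
  constructor
  · obtain ⟨u, hu, hwu⟩ : ∃ u, N u ≤ 1 ∧ ∑ j, w j * u j = -dualNorm N w :=
      exists_sum_mul_eq_neg_dualNorm p hN_eq w
    refine ⟨(y * ε) • u, ?_, ?_⟩
    · rw [hN_smul, abs_mul, hyabs, one_mul, abs_of_nonneg hε]
      exact mul_le_of_le_one_right hε hu
    · simp only [Pi.smul_apply, smul_eq_mul, mul_add, Finset.sum_add_distrib,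
        mul_left_comm (w _), ← Finset.mul_sum, hwu]
      congr 1
      linear_combination -ε * dualNorm N w * hy2
  · rintro _ ⟨δ, hδ, rfl⟩
    have hholder : |∑ j, w j * δ j| ≤ N δ * dualNorm N w :=
      abs_sum_mul_le_mul_dualNorm p hN_eq w δ
    have hdual : 0 ≤ dualNorm N w := by
      obtain ⟨u, -, h⟩ := (isGreatest_dualNorm p hN_eq w).1
      exact (abs_nonneg _).trans_eq h.symm
    have hbound : -(y * ∑ j, w j * δ j) ≤ ε * dualNorm N w := by
      refine (neg_le_abs _).trans ?_
      rw [abs_mul, hyabs, one_mul]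
      exact hholder.trans (mul_le_mul_of_nonneg_right hδ hdual)
    refine max_le_max_right 0 ?_
    simp only [mul_add, Finset.sum_add_distrib]
    linarith
end

section
/- Let ‖·‖ be a norm on ℝ^d, let x_1,…,x_n ∈ ℝ^d with labels y_1,…,y_n ∈ {−1,+1} be linearly separable through the origin, and let L(w) := Σ_{i=1}^n exp(−y_i⟨w, x_i⟩). For each λ > 0 the regularized objective L(w) + λ‖w‖ has a minimizer ŵ(λ); moreover, for every such choice of minimizers, ŵ(λ) ≠ 0 for all sufficiently small λ > 0 and the normalized margin converges to the maximum margin: lim_{λ→0⁺} min_i y_i⟨ŵ(λ), x_i⟩ / ‖ŵ(λ)‖ = max{ min_i y_i⟨w, x_i⟩ : ‖w‖ ≤ 1 }. -/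
open scoped BigOperators

section ExpLoss

variable {E ι : Type*} [NormedAddCommGroup E] [NormedSpace ℝ E]

/-- The minimal signed margin. -/
noncomputable def minMargin (f : ι → E →L[ℝ] ℝ) (w : E) : ℝ := ⨅ i, f i w

/-- The maximal margin over the unit ball. -/
noncomputable def maxMargin (f : ι → E →L[ℝ] ℝ) : ℝ :=
  sSup {m : ℝ | ∃ w : E, ‖w‖ ≤ 1 ∧ m = minMargin f w}

theorem minMargin_smul (f : ι → E →L[ℝ] ℝ) {c : ℝ} (hc : 0 ≤ c) (w : E) :
    minMargin f (c • w) = c * minMargin f w := by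
  simp only [minMargin, map_smul, smul_eq_mul]
  exact (Real.mul_iInf_of_nonneg hc _).symm

theorem minMargin_zero (f : ι → E →L[ℝ] ℝ) : minMargin f 0 = 0 := by
  simpa using minMargin_smul f le_rfl 0

theorem exists_lt_minMargin (f : ι → E →L[ℝ] ℝ) {a : ℝ} (ha : a < maxMargin f) :
    ∃ w : E, ‖w‖ ≤ 1 ∧ a < minMargin f w := by
  obtain ⟨_, ⟨w, hw, rfl⟩, h⟩ := exists_lt_of_lt_csSup
    (s := {m : ℝ | ∃ w : E, ‖w‖ ≤ 1 ∧ m = minMargin f w})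
    ⟨minMargin f 0, (0 : E), by simp, rfl⟩ ha
  exact ⟨w, hw, h⟩

variable [Fintype ι]

/-- The empirical risk with exponential loss for the signed margins `f i`. -/
noncomputable def expRisk (f : ι → E →L[ℝ] ℝ) (w : E) : ℝ := ∑ i, Real.exp (-f i w)

theorem expRisk_nonneg (f : ι → E →L[ℝ] ℝ) (w : E) : 0 ≤ expRisk f w :=
  Finset.sum_nonneg fun _ _ => (Real.exp_pos _).le

theorem exists_minimizer_expRisk_add_norm [FiniteDimensional ℝ E] (f : ι → E →L[ℝ] ℝ)
    {lam : ℝ} (hlam : 0 < lam) :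
    ∃ w, ∀ w', expRisk f w + lam * ‖w‖ ≤ expRisk f w' + lam * ‖w'‖ := by
  have : ProperSpace E := FiniteDimensional.proper ℝ E
  apply Continuous.exists_forall_le
  · unfold expRisk
    fun_prop
  · refine Filter.tendsto_atTop_mono (fun w => ?_)
      ((tendsto_norm_cocompact_atTop (E := E)).const_mul_atTop hlam)
    linarith [expRisk_nonneg f w]

theorem minMargin_le (f : ι → E →L[ℝ] ℝ) (w : E) (i : ι) : minMargin f w ≤ f i w :=
  ciInf_le (Set.finite_range _).bddBelow i

theorem expRisk_le (f : ι → E →L[ℝ] ℝ) (w : E) :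
    expRisk f w ≤ Fintype.card ι * Real.exp (-minMargin f w) := by
  have h := Finset.sum_le_card_nsmul Finset.univ (fun i => Real.exp (-f i w))
    (Real.exp (-minMargin f w))
    fun i _ => Real.exp_le_exp.2 (neg_le_neg (minMargin_le f w i))
  simpa [expRisk] using h

variable [Nonempty ι]

theorem exists_minMargin_eq (f : ι → E →L[ℝ] ℝ) (w : E) : ∃ i, f i w = minMargin f w :=
  exists_eq_ciInf_of_finite

theorem exp_neg_minMargin_le_expRisk (f : ι → E →L[ℝ] ℝ) (w : E) :
    Real.exp (-minMargin f w) ≤ expRisk f w := by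
  obtain ⟨i, hi⟩ := exists_minMargin_eq f w
  rw [← hi]
  exact Finset.single_le_sum (f := fun i => Real.exp (-f i w))
    (fun _ _ => (Real.exp_pos _).le) (Finset.mem_univ i)

theorem bddAbove_minMargin_unitBall (f : ι → E →L[ℝ] ℝ) :
    BddAbove {m : ℝ | ∃ w : E, ‖w‖ ≤ 1 ∧ m = minMargin f w} := by
  obtain ⟨i⟩ := ‹Nonempty ι›
  refine ⟨‖f i‖, ?_⟩
  rintro m ⟨w, hw, rfl⟩
  calc minMargin f w ≤ f i w := minMargin_le f w i
    _ ≤ ‖f i w‖ := Real.le_norm_self _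
    _ ≤ ‖f i‖ * ‖w‖ := (f i).le_opNorm w
    _ ≤ ‖f i‖ := mul_le_of_le_one_right (norm_nonneg _) hw

theorem minMargin_div_norm_le_maxMargin (f : ι → E →L[ℝ] ℝ) {w : E} (hw : w ≠ 0) :
    minMargin f w / ‖w‖ ≤ maxMargin f := by
  refine le_csSup (bddAbove_minMargin_unitBall f) ⟨‖w‖⁻¹ • w, ?_, ?_⟩
  · simp [norm_smul, hw]
  · rw [minMargin_smul f (by positivity), div_eq_inv_mul]

theorem minMargin_le_maxMargin_mul_norm (f : ι → E →L[ℝ] ℝ) (w : E) :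
    minMargin f w ≤ maxMargin f * ‖w‖ := by
  rcases eq_or_ne w 0 with rfl | hw
  · simp [minMargin_zero]
  · exact (div_le_iff₀ (norm_pos_iff.2 hw)).1 (minMargin_div_norm_le_maxMargin f hw)

theorem maxMargin_pos (f : ι → E →L[ℝ] ℝ) (hsep : ∃ w, ∀ i, 0 < f i w) :
    0 < maxMargin f := by
  obtain ⟨w, hw⟩ := hsep
  obtain ⟨i, hi⟩ := exists_minMargin_eq f w
  have h := hi ▸ hw i
  exact pos_of_mul_pos_left (h.trans_le (minMargin_le_maxMargin_mul_norm f w)) (norm_nonneg w)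

variable {f : ι → E →L[ℝ] ℝ} {what : ℝ → E}

theorem exp_neg_minMargin_add_le_of_isMin {lam : ℝ} (hlam : 0 < lam) {v w : E}
    (hv : ∀ w', expRisk f v + lam * ‖v‖ ≤ expRisk f w' + lam * ‖w'‖) (hw : ‖w‖ ≤ 1)
    {t : ℝ} (ht : 0 ≤ t) :
    Real.exp (-minMargin f v) + lam * ‖v‖ ≤
      Fintype.card ι * Real.exp (-(t * minMargin f w)) + lam * t := by
  have hle := expRisk_le f (t • w)
  rw [minMargin_smul f ht] at hle
  have hn : ‖t • w‖ ≤ t := by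
    rw [norm_smul, Real.norm_of_nonneg ht]
    exact mul_le_of_le_one_right ht hw
  linarith [hv (t • w), exp_neg_minMargin_le_expRisk f v, mul_le_mul_of_nonneg_left hn hlam.le]

theorem tendsto_norm_minimizer_atTop (hsep : ∃ w, ∀ i, 0 < f i w)
    (hmin : ∀ lam, 0 < lam → ∀ w',
      expRisk f (what lam) + lam * ‖what lam‖ ≤ expRisk f w' + lam * ‖w'‖) :
    Filter.Tendsto (fun lam => ‖what lam‖) (nhdsWithin 0 (Set.Ioi 0)) Filter.atTop := by
  have hpos := maxMargin_pos f hsep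
  obtain ⟨w, hw, hmw⟩ := exists_lt_minMargin f hpos
  rw [Filter.tendsto_atTop]
  intro R
  have hlim : Filter.Tendsto
      (fun t : ℝ => Fintype.card ι * Real.exp (-(t * minMargin f w))) Filter.atTop (nhds 0) := by
    have h := (Real.tendsto_exp_neg_atTop_nhds_zero.comp
      (Filter.tendsto_id.atTop_mul_const hmw)).const_mul (Fintype.card ι : ℝ)
    simpa using h
  obtain ⟨t, ht, ht0⟩ := ((hlim.eventually_lt_const
    (Real.exp_pos (-(maxMargin f * R)))).and (Filter.eventually_ge_atTop 0)).exists
  have hlin : Filter.Tendsto (fun lam : ℝ =>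
      Fintype.card ι * Real.exp (-(t * minMargin f w)) + lam * t) (nhdsWithin 0 (Set.Ioi 0))
      (nhds (Fintype.card ι * Real.exp (-(t * minMargin f w)))) := by
    refine Filter.Tendsto.mono_left ?_ nhdsWithin_le_nhds
    exact Continuous.tendsto' (by fun_prop) _ _ (by simp)
  filter_upwards [hlin.eventually_lt_const ht, self_mem_nhdsWithin] with lam hlt hlam
  have hlam : 0 < lam := hlam
  have h := exp_neg_minMargin_add_le_of_isMin hlam (hmin lam hlam) hw ht0
  have hnn : 0 ≤ lam * ‖what lam‖ := by positivity
  have hexp := Real.exp_lt_exp.1 ((le_add_of_nonneg_right hnn).trans_lt (h.trans_lt hlt))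
  have hub := minMargin_le_maxMargin_mul_norm f (what lam)
  exact (lt_of_mul_lt_mul_left (by linarith : maxMargin f * R < maxMargin f * ‖what lam‖)
    hpos.le).le

theorem tendsto_normalized_margin (hsep : ∃ w, ∀ i, 0 < f i w)
    (hmin : ∀ lam, 0 < lam → ∀ w',
      expRisk f (what lam) + lam * ‖what lam‖ ≤ expRisk f w' + lam * ‖w'‖) :
    Filter.Tendsto (fun lam => minMargin f (what lam) / ‖what lam‖)
      (nhdsWithin 0 (Set.Ioi 0)) (nhds (maxMargin f)) := by
  have hnorm := tendsto_norm_minimizer_atTop hsep hmin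
  refine tendsto_order.2 ⟨fun a ha => ?_, fun b hb => ?_⟩
  · obtain ⟨w, hw, haw⟩ := exists_lt_minMargin f ha
    have hcard : (0 : ℝ) < Fintype.card ι := by exact_mod_cast Fintype.card_pos
    filter_upwards [hnorm.eventually_gt_atTop 0, self_mem_nhdsWithin,
      hnorm.eventually_gt_atTop (Real.log (Fintype.card ι) / (minMargin f w - a))]
      with lam hR hlam hlog
    have h := exp_neg_minMargin_add_le_of_isMin hlam (hmin lam hlam) hw hR.le
    rw [add_le_add_iff_right] at h
    have h' := Real.log_le_log (Real.exp_pos _) h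
    rw [Real.log_exp, Real.log_mul hcard.ne' (Real.exp_pos _).ne', Real.log_exp] at h'
    rw [div_lt_iff₀ (sub_pos.2 haw)] at hlog
    rw [lt_div_iff₀ hR]
    linarith
  · filter_upwards [hnorm.eventually_gt_atTop 0] with lam hR
    exact (minMargin_div_norm_le_maxMargin f (norm_pos_iff.1 hR)).trans_lt hb

theorem exists_forall_minimizer_ne_zero (hsep : ∃ w, ∀ i, 0 < f i w)
    (hmin : ∀ lam, 0 < lam → ∀ w',
      expRisk f (what lam) + lam * ‖what lam‖ ≤ expRisk f w' + lam * ‖w'‖) :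
    ∃ lam0 : ℝ, 0 < lam0 ∧ ∀ lam, 0 < lam → lam ≤ lam0 → what lam ≠ 0 := by
  obtain ⟨u, hu, h⟩ := (mem_nhdsGT_iff_exists_Ioc_subset).1
    ((tendsto_norm_minimizer_atTop hsep hmin).eventually_gt_atTop 0)
  exact ⟨u, hu, fun lam h0 h1 => norm_pos_iff.1 (h ⟨h0, h1⟩)⟩

end ExpLoss

/-- A subadditive, absolutely homogeneous, definite function satisfies the norm axioms. -/
theorem normedSpaceCore_of_subadditive {V : Type*} [AddCommGroup V] [Module ℝ V] (N : V → ℝ)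
    (hN_tri : ∀ u v, N (u + v) ≤ N u + N v) (hN_smul : ∀ (c : ℝ) v, N (c • v) = |c| * N v)
    (hN_eq : ∀ v, N v = 0 → v = 0) :
    letI : Norm V := ⟨N⟩
    NormedSpace.Core ℝ V := by
  let : Norm V := ⟨N⟩
  have hzero : N 0 = 0 := by simpa using hN_smul 0 0
  refine { norm_nonneg := fun v => ?_, norm_smul := hN_smul, norm_triangle := hN_tri,
           norm_eq_zero_iff := fun v => ⟨hN_eq v, fun h => h ▸ hzero⟩ }
  have h := hN_tri v ((-1 : ℝ) • v)
  rw [hN_smul] at h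
  simp only [neg_smul, one_smul, add_neg_cancel, hzero, abs_neg, abs_one, one_mul] at h
  change 0 ≤ N v
  linarith

/-- The signed margin functional of a labelled point. -/
def signedMargin {d : ℕ} (x : Fin d → ℝ) (y : ℝ) : (Fin d → ℝ) →ₗ[ℝ] ℝ where
  toFun w := y * ∑ j, w j * x j
  map_add' u v := by simp only [Pi.add_apply, add_mul, Finset.sum_add_distrib, mul_add]
  map_smul' c v := by
    simp only [Pi.smul_apply, smul_eq_mul, mul_assoc, ← Finset.mul_sum, RingHom.id_apply]
    ring

/-- For margins given by linear functionals on a finite-dimensional space with an arbitrary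
norm `N`, minimizers exist along the regularization path and their normalized margins tend to
the maximum margin. -/
theorem regularization_path {V ι : Type*} [AddCommGroup V] [Module ℝ V]
    [FiniteDimensional ℝ V] [Fintype ι] [Nonempty ι] (N : V → ℝ)
    (hN_tri : ∀ u v, N (u + v) ≤ N u + N v) (hN_smul : ∀ (c : ℝ) v, N (c • v) = |c| * N v)
    (hN_eq : ∀ v, N v = 0 → v = 0) (g : ι → V →ₗ[ℝ] ℝ) (hsep : ∃ w, ∀ i, 0 < g i w) :
    (∀ lam : ℝ, 0 < lam → ∃ w : V, ∀ w' : V,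
        (∑ i, Real.exp (-g i w)) + lam * N w ≤ (∑ i, Real.exp (-g i w')) + lam * N w') ∧
    ∀ what : ℝ → V,
      (∀ lam : ℝ, 0 < lam → ∀ w' : V,
          (∑ i, Real.exp (-g i (what lam))) + lam * N (what lam)
            ≤ (∑ i, Real.exp (-g i w')) + lam * N w') →
      (∃ lam0 : ℝ, 0 < lam0 ∧ ∀ lam : ℝ, 0 < lam → lam ≤ lam0 → what lam ≠ 0) ∧
      Filter.Tendsto (fun lam => (⨅ i, g i (what lam)) / N (what lam))
        (nhdsWithin 0 (Set.Ioi (0 : ℝ)))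
        (nhds (sSup {m : ℝ | ∃ w : V, N w ≤ 1 ∧ m = ⨅ i, g i w})) := by
  let : Norm V := ⟨N⟩
  have hcore : NormedSpace.Core ℝ V := normedSpaceCore_of_subadditive N hN_tri hN_smul hN_eq
  let : NormedAddCommGroup V := NormedAddCommGroup.ofCore hcore
  let : NormedSpace ℝ V := NormedSpace.ofCore hcore
  let f : ι → V →L[ℝ] ℝ := fun i => (g i).toContinuousLinearMap
  exact ⟨fun _ hlam => exists_minimizer_expRisk_add_norm f hlam, fun _ hmin =>
    ⟨exists_forall_minimizer_ne_zero (f := f) hsep hmin,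
      tendsto_normalized_margin (f := f) hsep hmin⟩⟩

/-- For linearly separable data (through the origin), exponential loss
`L(w) = Σᵢ exp(−yᵢ⟨w,xᵢ⟩)` and any norm `N`: for every `λ > 0` the regularized objective
`L(w) + λ N(w)` has a minimizer; and for every choice `ŵ(λ)` of minimizers, `ŵ(λ) ≠ 0`
for all sufficiently small `λ > 0` and the normalized margin of `ŵ(λ)` converges, as
`λ → 0⁺`, to the maximum margin over the `N`-unit ball. -/
theorem stmt18 {d n : ℕ} (hn : 0 < n)
    (N : (Fin d → ℝ) → ℝ)
    (hN_tri : ∀ u v : Fin d → ℝ, N (u + v) ≤ N u + N v)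
    (hN_smul : ∀ (c : ℝ) (v : Fin d → ℝ), N (c • v) = |c| * N v)
    (hN_eq : ∀ v : Fin d → ℝ, N v = 0 → v = 0)
    (x : Fin n → Fin d → ℝ) (y : Fin n → ℝ)
    (hy : ∀ i, y i = 1 ∨ y i = -1)
    (hsep : ∃ w : Fin d → ℝ, ∀ i, 0 < y i * ∑ j, w j * x i j) :
    (∀ lam : ℝ, 0 < lam → ∃ w : Fin d → ℝ, ∀ w' : Fin d → ℝ,
        (∑ i, Real.exp (-(y i) * ∑ j, w j * x i j)) + lam * N w
          ≤ (∑ i, Real.exp (-(y i) * ∑ j, w' j * x i j)) + lam * N w') ∧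
    ∀ what : ℝ → Fin d → ℝ,
      (∀ lam : ℝ, 0 < lam → ∀ w' : Fin d → ℝ,
          (∑ i, Real.exp (-(y i) * ∑ j, what lam j * x i j)) + lam * N (what lam)
            ≤ (∑ i, Real.exp (-(y i) * ∑ j, w' j * x i j)) + lam * N w') →
      (∃ lam0 : ℝ, 0 < lam0 ∧ ∀ lam : ℝ, 0 < lam → lam ≤ lam0 → what lam ≠ 0) ∧
      Filter.Tendsto
        (fun lam => (⨅ i, y i * ∑ j, what lam j * x i j) / N (what lam))
        (nhdsWithin 0 (Set.Ioi (0 : ℝ)))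
        (nhds (sSup {m : ℝ | ∃ w : Fin d → ℝ, N w ≤ 1 ∧
            m = ⨅ i, y i * ∑ j, w j * x i j})) := by
  have : Nonempty (Fin n) := ⟨⟨0, hn⟩⟩
  simp only [neg_mul]
  exact regularization_path N hN_tri hN_smul hN_eq (fun i => signedMargin (x i) (y i)) hsep
end
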